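/- For every ξ ∈ ℝ² the infimum defining φ(ξ) is attained: there exist N ∈ ℕ, coefficients λ_k ≥ 0 and vectors ξ_k ∈ 𝕊 (k = 1, …, N) with Σ_{k=1}^N λ_k ξ_k = ξ and φ(ξ) = Σ_{k=1}^N λ_k ψ(ξ_k). -/

import Mathlib

open MeasureTheory Real Filter Set Metric
open scoped Topology

noncomputable section

abbrev E2 : Type := EuclideanSpace ℝ (Fin 2)

/-- The set whose infimum defines the relaxed density `φ(ξ)`. -/
def phiSet (𝒮 : Set E2) (ψ : E2 → ℝ) (ξ : E2) : Set ℝ :=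
  {t | ∃ (N : ℕ) (lam : Fin N → ℝ) (ξs : Fin N → E2),
    (∀ k, 0 ≤ lam k) ∧ (∀ k, ξs k ∈ Submodule.span ℤ 𝒮) ∧
    (∑ k, lam k • ξs k) = ξ ∧ t = ∑ k, lam k * ψ (ξs k)}

/-- The relaxed density `φ(ξ) := inf { ∑ λ_k ψ(ξ_k) : ∑ λ_k ξ_k = ξ, λ_k ≥ 0, ξ_k ∈ 𝕊 }`. -/
def phi (𝒮 : Set E2) (ψ : E2 → ℝ) (ξ : E2) : ℝ := sInf (phiSet 𝒮 ψ ξ)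

/-- `t` bounds the cost, with respect to the weights `w`, of some representation of `ξ` as a
conic combination of the vectors `v`. -/
def IsConicBound {ι E : Type*} [Fintype ι] [AddCommGroup E] [Module ℝ E]
    (v : ι → E) (w : ι → ℝ) (ξ : E) (t : ℝ) : Prop :=
  ∃ μ : ι → ℝ, (∀ i, 0 ≤ μ i) ∧ ∑ i, μ i • v i = ξ ∧ ∑ i, μ i * w i ≤ t

namespace IsConicBound

section Module

variable {ι E : Type*} [Fintype ι] [AddCommGroup E] [Module ℝ E] {v : ι → E} {w : ι → ℝ}
  {ξ η : E} {s t : ℝ}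

lemma mono (h : IsConicBound v w ξ s) (hst : s ≤ t) : IsConicBound v w ξ t :=
  let ⟨μ, hμ, hξ, hs⟩ := h
  ⟨μ, hμ, hξ, hs.trans hst⟩

lemma zero : IsConicBound v w 0 0 := ⟨0, by simp, by simp, by simp⟩

lemma add (hξ : IsConicBound v w ξ s) (hη : IsConicBound v w η t) :
    IsConicBound v w (ξ + η) (s + t) := by
  obtain ⟨μ, hμ, rfl, hs⟩ := hξ
  obtain ⟨ν, hν, rfl, ht⟩ := hη
  refine ⟨μ + ν, fun i => add_nonneg (hμ i) (hν i), ?_, ?_⟩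
  · simp [add_smul, Finset.sum_add_distrib]
  · simpa [add_mul, Finset.sum_add_distrib] using add_le_add hs ht

lemma smul {a : ℝ} (ha : 0 ≤ a) (hξ : IsConicBound v w ξ t) :
    IsConicBound v w (a • ξ) (a * t) := by
  obtain ⟨μ, hμ, rfl, ht⟩ := hξ
  refine ⟨a • μ, fun i => mul_nonneg ha (hμ i), ?_, ?_⟩
  · simp [Finset.smul_sum, mul_smul]
  · simpa [Finset.mul_sum, mul_assoc] using mul_le_mul_of_nonneg_left ht ha

lemma sum {κ : Type*} (S : Finset κ) {ζ : κ → E} {τ : κ → ℝ}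
    (h : ∀ k ∈ S, IsConicBound v w (ζ k) (τ k)) :
    IsConicBound v w (∑ k ∈ S, ζ k) (∑ k ∈ S, τ k) := by
  classical
  induction S using Finset.induction_on with
  | empty => simpa using zero
  | insert k S hk ih =>
    rw [Finset.sum_insert hk, Finset.sum_insert hk]
    exact (h k (Finset.mem_insert_self k S)).add
      (ih fun j hj => h j (Finset.mem_insert_of_mem hj))

lemma apply (i : ι) : IsConicBound v w (v i) (w i) := by
  classical
  refine ⟨Pi.single i 1, fun j => ?_, ?_, ?_⟩
  · by_cases h : j = i <;> simp [h]
  · simp [Pi.single_apply]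
  · simp [Pi.single_apply]

lemma smul_of_abs {a : ℝ} (hpos : IsConicBound v w ξ t) (hneg : IsConicBound v w (-ξ) t) :
    IsConicBound v w (a • ξ) (|a| * t) := by
  rcases le_total 0 a with ha | ha
  · simpa [abs_of_nonneg ha] using hpos.smul ha
  · simpa [abs_of_nonpos ha] using hneg.smul (neg_nonneg.2 ha)

end Module

/-- For positive weights, the least cost of a conic representation is attained. -/
lemma exists_minimizer {ι E : Type*} [Fintype ι] [NormedAddCommGroup E] [NormedSpace ℝ E]
    {v : ι → E} {w : ι → ℝ} (hw : ∀ i, 0 < w i) {ξ : E} {t : ℝ} (h : IsConicBound v w ξ t) :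
    ∃ μ : ι → ℝ, (∀ i, 0 ≤ μ i) ∧ ∑ i, μ i • v i = ξ ∧
      ∀ s, IsConicBound v w ξ s → ∑ i, μ i * w i ≤ s := by
  set K : Set (ι → ℝ) := {μ | (∀ i, 0 ≤ μ i) ∧ ∑ i, μ i • v i = ξ ∧ ∑ i, μ i * w i ≤ t}
  have hclosed : IsClosed K :=
    (isClosed_Ici (a := (0 : ι → ℝ))).inter
      ((isClosed_eq (f := fun μ : ι → ℝ => ∑ i, μ i • v i) (by fun_prop)
        continuous_const).inter
      (isClosed_le (f := fun μ : ι → ℝ => ∑ i, μ i * w i) (by fun_prop) continuous_const))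
  have hsub : K ⊆ Icc 0 fun i => t / w i := fun μ ⟨hμ, _, ht⟩ =>
    ⟨hμ, fun i => (le_div_iff₀ (hw i)).2 <|
      (Finset.single_le_sum (f := fun j => μ j * w j)
        (fun j _ => mul_nonneg (hμ j) (hw j).le) (Finset.mem_univ i)).trans ht⟩
  obtain ⟨μ, ⟨hμ, hξ, ht⟩, hmin⟩ := (isCompact_Icc.of_isClosed_subset hclosed hsub).exists_isMinOn
    h (f := fun μ : ι → ℝ => ∑ i, μ i * w i) (by fun_prop)
  refine ⟨μ, hμ, hξ, ?_⟩
  rintro s ⟨ν, hν, hνξ, hνs⟩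
  refine le_trans ?_ hνs
  rcases le_total (∑ i, ν i * w i) t with hνt | hνt
  · exact hmin ⟨hν, hνξ, hνt⟩
  · exact ht.trans hνt

end IsConicBound

lemma AddSubgroup.finite_inter_closedBall {E : Type*} [NormedAddCommGroup E] [ProperSpace E]
    (L : AddSubgroup E) {δ : ℝ} (hδ : 0 < δ) (hL : ∀ x ∈ L, x ≠ 0 → δ ≤ ‖x‖) (R : ℝ) :
    (closedBall (0 : E) R ∩ L).Finite := by
  have : DiscreteTopology L := .of_forall_le_norm hδ fun x hx =>
    hL x x.2 (by simpa using hx)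
  exact Metric.finite_isBounded_inter_isClosed DiscreteTopology.isDiscrete isBounded_closedBall
    AddSubgroup.isClosed_of_discrete

/-- Every lattice vector is represented, at no greater cost than its own, by nonzero lattice
vectors from a suitable ball: splitting a vector along a basis contained in the lattice costs at
most linearly in its norm, whereas the self-energy grows quadratically. -/
lemma exists_radius_isConicBound {ι E : Type*} [Fintype ι] [NormedAddCommGroup E]
    [NormedSpace ℝ E] [FiniteDimensional ℝ E] (L : AddSubgroup E) (b : Module.Basis ι ℝ E)
    (hb : ∀ i, b i ∈ L) {ψ : E → ℝ} {c : ℝ} (hc : 0 < c)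
    (hψ : ∀ x, c⁻¹ * ‖x‖ ^ 2 ≤ ψ x ∧ ψ x ≤ c * ‖x‖ ^ 2) :
    ∃ R : ℝ, ∀ F : Finset E, (∀ x, x ∈ F ↔ x ∈ L ∧ x ≠ 0 ∧ ‖x‖ ≤ R) →
      (∀ x, ∃ t, IsConicBound (fun y : F => (y : E)) (fun y : F => ψ y) x t) ∧
      ∀ x ∈ L, IsConicBound (fun y : F => (y : E)) (fun y : F => ψ y) x (ψ x) := by
  let f : ι → E →L[ℝ] ℝ := fun i => (b.coord i).toContinuousLinearMap
  let M : ℝ := ∑ i, ‖f i‖ * (c * ‖b i‖ ^ 2)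
  have hM : 0 ≤ M := Finset.sum_nonneg fun i _ => by positivity
  have hbR : ∀ i, ‖b i‖ ≤ c * M + ∑ j, ‖b j‖ := fun i =>
    (Finset.single_le_sum (f := fun j => ‖b j‖) (fun j _ => norm_nonneg _)
      (Finset.mem_univ i)).trans (le_add_of_nonneg_left (by positivity))
  refine ⟨c * M + ∑ j, ‖b j‖, fun F hF => ?_⟩
  have hmem : ∀ x ∈ F, IsConicBound (fun y : F => (y : E)) (fun y : F => ψ y) x (ψ x) :=
    fun x hx => .apply (v := fun y : F => (y : E)) (w := fun y : F => ψ y) ⟨x, hx⟩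
  have hsplit : ∀ x,
      IsConicBound (fun y : F => (y : E)) (fun y : F => ψ y) x (M * ‖x‖) := by
    intro x
    have hx : ∑ i, f i x • b i = x := b.sum_repr x
    have hsum := IsConicBound.sum Finset.univ fun i _ =>
      IsConicBound.smul_of_abs (a := f i x) (t := c * ‖b i‖ ^ 2)
        ((hmem (b i) ((hF _).2 ⟨hb i, b.ne_zero i, hbR i⟩)).mono (hψ _).2)
        ((hmem (-b i) ((hF _).2 ⟨neg_mem (hb i), neg_ne_zero.2 (b.ne_zero i),
          by simpa using hbR i⟩)).mono (by simpa using (hψ (-b i)).2))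
    rw [hx] at hsum
    refine hsum.mono ?_
    rw [Finset.sum_mul]
    refine Finset.sum_le_sum fun i _ => ?_
    calc |f i x| * (c * ‖b i‖ ^ 2) ≤ (‖f i‖ * ‖x‖) * (c * ‖b i‖ ^ 2) := by
          gcongr
          exact (f i).le_opNorm x
      _ = ‖f i‖ * (c * ‖b i‖ ^ 2) * ‖x‖ := by ring
  refine ⟨fun x => ⟨_, hsplit x⟩, fun x hx => ?_⟩
  by_cases hxF : x ∈ F
  · exact hmem x hxF
  rcases eq_or_ne x 0 with rfl | hx0
  · exact IsConicBound.zero.mono (by simpa using (hψ 0).1)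
  · have hlarge : c * M ≤ ‖x‖ := by
      by_contra! hlt
      exact hxF ((hF x).2 ⟨hx, hx0, hlt.le.trans (le_add_of_nonneg_right (by positivity))⟩)
    refine (hsplit x).mono (le_trans ?_ (hψ x).1)
    rw [inv_mul_eq_div, le_div_iff₀ hc]
    nlinarith [mul_le_mul_of_nonneg_right hlarge (norm_nonneg x)]

/-- Proposition 3.5 (part): the infimum defining  is attained. -/
theorem phi_inf_attained (𝒮 : Set E2) (hfin : 𝒮.Finite)
    (hindep : ∃ b₁ ∈ 𝒮, ∃ b₂ ∈ 𝒮, LinearIndependent ℝ ![b₁, b₂])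
    (hdisc : ∃ δ > 0, ∀ ξ ∈ Submodule.span ℤ 𝒮, ξ ≠ 0 → δ ≤ ‖ξ‖)
    (ψ : E2 → ℝ) (c : ℝ) (hc : 0 < c)
    (hψ : ∀ ξ : E2, c⁻¹ * ‖ξ‖^2 ≤ ψ ξ ∧ ψ ξ ≤ c * ‖ξ‖^2) :
    ∀ ξ : E2, ∃ (N : ℕ) (lam : Fin N → ℝ) (ξs : Fin N → E2),
      (∀ k, 0 ≤ lam k) ∧ (∀ k, ξs k ∈ Submodule.span ℤ 𝒮) ∧
      (∑ k, lam k • ξs k) = ξ ∧ phi 𝒮 ψ ξ = ∑ k, lam k * ψ (ξs k) := by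
  intro ξ
  obtain ⟨b₁, hb₁, b₂, hb₂, hli⟩ := hindep
  obtain ⟨δ, hδ, hdisc⟩ := hdisc
  let L : AddSubgroup E2 := (Submodule.span ℤ 𝒮).toAddSubgroup
  let b : Module.Basis (Fin 2) ℝ E2 := basisOfLinearIndependentOfCardEqFinrank hli (by simp)
  have hbL : ∀ i, b i ∈ L := by
    intro i
    rw [coe_basisOfLinearIndependentOfCardEqFinrank]
    fin_cases i
    · exact Submodule.subset_span hb₁
    · exact Submodule.subset_span hb₂
  obtain ⟨R, hR⟩ := exists_radius_isConicBound L b hbL hc hψ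
  let F : Finset E2 := ((L.finite_inter_closedBall hδ hdisc R).sdiff (t := {0})).toFinset
  have hF : ∀ x, x ∈ F ↔ x ∈ L ∧ x ≠ 0 ∧ ‖x‖ ≤ R := by
    intro x
    simp only [F, Set.Finite.mem_toFinset, Set.mem_sdiff, mem_inter_iff, mem_closedBall_zero_iff,
      SetLike.mem_coe, mem_singleton_iff]
    tauto
  obtain ⟨hfeas, hred⟩ := hR F hF
  have hpos : ∀ y : F, 0 < ψ y := fun y => by
    have : 0 < ‖(y : E2)‖ := norm_pos_iff.2 ((hF y).1 y.2).2.1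
    exact lt_of_lt_of_le (by positivity) (hψ y).1
  obtain ⟨t, ht⟩ := hfeas ξ
  obtain ⟨μ, hμ, hμξ, hmin⟩ := ht.exists_minimizer hpos
  let e := (Fintype.equivFin F).symm
  have hξ : ∑ k, μ (e k) • (e k : E2) = ξ := by
    rw [← hμξ]
    exact e.sum_comp fun y => μ y • (y : E2)
  refine ⟨_, fun k => μ (e k), fun k => e k, fun k => hμ _, fun k => ((hF _).1 (e k).2).1,
    hξ, IsLeast.csInf_eq ⟨⟨_, _, _, fun k => hμ _, fun k => ((hF _).1 (e k).2).1, hξ, rfl⟩, ?_⟩⟩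
  rintro _ ⟨N, lam, ξs, hlam, hξs, hsum, rfl⟩
  rw [e.sum_comp fun y => μ y * ψ y]
  apply hmin
  rw [← hsum]
  exact IsConicBound.sum _ fun k _ => (hred _ (hξs k)).smul (hlam k)
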